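/- arXiv:0705.1699 — 2 statements merged into one kernel-verified Lean document; each statement's English description precedes it below -/
import Mathlib

section
/- For every real r > 0, every ε with 0 < ε < 2r, and all complex numbers a, c, the following two contour integrals over the positively oriented circle of radius ε centered at ir both vanish: ∮_{|z−ir|=ε} z·((z·c − r·a) + i(z·a + r·c))/((z+ir)(z−ir)³) dz = 0 and ∮_{|z−ir|=ε} z·((z·c − r·a) − i(z·a + r·c))/((z−ir)(z+ir)³) dz = 0. -/
/-- The rational function `z ↦ k * z / (z - p) ^ 3` has a primitive away from its pole `p`, so its
integral over any circle avoiding `p` vanishes. -/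
theorem circleIntegral_mul_div_sub_pow_three_eq_zero (k p x : ℂ) {R : ℝ} (hR : 0 ≤ R)
    (hp : p ∉ Metric.sphere x R) : (∮ z in C(x, R), k * z / (z - p) ^ 3) = 0 := by
  refine circleIntegral.integral_eq_zero_of_hasDerivWithinAt
    (f := fun z => k * (p - 2 * z) / (2 * (z - p) ^ 2)) hR fun z hz => ?_
  have hzp : z - p ≠ 0 := sub_ne_zero.2 fun h => hp (h ▸ hz)
  have hnum : HasDerivAt (fun w : ℂ => k * (p - 2 * w)) (k * -(2 * 1)) z :=
    (((hasDerivAt_id z).const_mul 2).const_sub p).const_mul k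
  have hden : HasDerivAt (fun w : ℂ => 2 * (w - p) ^ 2) (2 * ((2 : ℕ) * (z - p) ^ (2 - 1) * 1)) z :=
    (((hasDerivAt_id z).sub_const p).pow 2).const_mul 2
  refine ((hnum.div hden (mul_ne_zero two_ne_zero (pow_ne_zero 2 hzp))).congr_deriv ?_).hasDerivWithinAt
  push_cast
  field_simp
  ring

/-- For `r > 0`, `0 < ε < 2r` and complex `a, c`, the contour integrals
`∮_{|z−ir|=ε} z·((z·c − r·a) + i(z·a + r·c))/((z+ir)(z−ir)³) dz` and
`∮_{|z−ir|=ε} z·((z·c − r·a) − i(z·a + r·c))/((z−ir)(z+ir)³) dz` both vanish. -/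
theorem stmt_13 (r : ℝ) (hr : 0 < r) (ε : ℝ) (hε : 0 < ε) (hε2 : ε < 2 * r) (a c : ℂ) :
    (∮ z in C(Complex.I * r, ε),
        z * ((z * c - r * a) + Complex.I * (z * a + r * c)) /
          ((z + Complex.I * r) * (z - Complex.I * r) ^ 3)) = 0 ∧
      (∮ z in C(Complex.I * r, ε),
        z * ((z * c - r * a) - Complex.I * (z * a + r * c)) /
          ((z - Complex.I * r) * (z + Complex.I * r) ^ 3)) = 0 := by
  have hI : Complex.I * Complex.I = -1 := Complex.I_mul_I
  have hcenter : Complex.I * r ∉ Metric.sphere (Complex.I * r) ε := by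
    simp [hε.ne]
  have hopp : -(Complex.I * r) ∉ Metric.sphere (Complex.I * r) ε := by
    intro h
    rw [mem_sphere_iff_norm, show -(Complex.I * r) - Complex.I * r = -(2 * (Complex.I * r)) by ring,
      norm_neg, norm_mul, norm_mul, Complex.norm_I, Complex.norm_real, Real.norm_of_nonneg hr.le,
      Complex.norm_two] at h
    linarith
  constructor
  · rw [← circleIntegral_mul_div_sub_pow_three_eq_zero (c + Complex.I * a) _ _ hε.le hcenter]
    refine circleIntegral.integral_congr hε.le fun z hz => ?_
    have hsub : z - Complex.I * r ≠ 0 := sub_ne_zero.2 fun h => hcenter (h ▸ hz)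
    have hadd : z + Complex.I * r ≠ 0 := fun h => hopp (eq_neg_of_add_eq_zero_left h ▸ hz)
    rw [div_eq_div_iff (mul_ne_zero hadd (pow_ne_zero 3 hsub)) (pow_ne_zero 3 hsub)]
    linear_combination -z * r * a * (z - Complex.I * r) ^ 3 * hI
  · rw [← circleIntegral_mul_div_sub_pow_three_eq_zero (c - Complex.I * a) _ _ hε.le hopp]
    refine circleIntegral.integral_congr hε.le fun z hz => ?_
    have hsub : z - Complex.I * r ≠ 0 := sub_ne_zero.2 fun h => hcenter (h ▸ hz)
    have hadd : z + Complex.I * r ≠ 0 := fun h => hopp (eq_neg_of_add_eq_zero_left h ▸ hz)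
    simp only [sub_neg_eq_add]
    rw [div_eq_div_iff (mul_ne_zero hsub (pow_ne_zero 3 hadd)) (pow_ne_zero 3 hadd)]
    linear_combination -z * r * a * (z + Complex.I * r) ^ 3 * hI
end

section
/- Let f : ℝ^m → Λ(ℂ^m) be a twice continuously differentiable function with values in the exterior algebra of ℂ^m. Let C_j f = w_j·f − ∂_{w_j} f and C_j^* f = w_j·f + ∂_{w_j} f act componentwise, and let e_j, ε_j act pointwise on the values of f. Define D₊ f = i·Σ_{j=1}^m (e_j(C_j f) − ε_j(C_j^* f)) and D₋ f = i·Σ_{j=1}^m (e_j(C_j^* f) − ε_j(C_j f)). Then D₊(D₊ f) = Σ_{j=1}^m C_j(C_j^* f) + 2·Σ_{j=1}^m ε_j(e_j f) and D₋(D₋ f) = Σ_{j=1}^m C_j(C_j^* f) + 2·Σ_{j=1}^m e_j(ε_j f). -/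
/-! We model the exterior algebra `Λ(ℂ^m)` of `ℂ^m` concretely as the space
`Finset (Fin m) → ℂ` of coefficient families with respect to the standard basis
`b_S = b_{i₁} ∧ ⋯ ∧ b_{i_k}` (indices increasing), so that it carries the product norm
and functions into it can be differentiated.  The operators `ε_j` (left exterior
multiplication by `b_j`) and `e_j` (contraction with the `j`-th dual basis vector) are
given by their standard action on these coordinates. -/

/-- The sign `(−1)^{#{i ∈ S : i < j}}`. -/
noncomputable def basisSign {m : ℕ} (j : Fin m) (S : Finset (Fin m)) : ℂ :=
  (-1) ^ (S.filter (· < j)).card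

/-- Left exterior multiplication `ε_j` by the `j`-th standard basis vector of `ℂ^m`,
in the coordinates of `Λ(ℂ^m)` described above. -/
noncomputable def wedgeOp {m : ℕ} (j : Fin m) (f : Finset (Fin m) → ℂ) :
    Finset (Fin m) → ℂ :=
  fun S => if j ∈ S then basisSign j S * f (S.erase j) else 0

/-- Contraction `e_j` with the `j`-th dual basis vector, in the coordinates of `Λ(ℂ^m)`
described above. -/
noncomputable def contrOp {m : ℕ} (j : Fin m) (f : Finset (Fin m) → ℂ) :
    Finset (Fin m) → ℂ :=
  fun S => if j ∈ S then 0 else basisSign j S * f (insert j S)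

/-- The partial derivative `∂_{w_j} f` of an `Λ(ℂ^m)`-valued function on `ℝ^m`. -/
noncomputable def pdE {m : ℕ} (j : Fin m) (f : (Fin m → ℝ) → Finset (Fin m) → ℂ) :
    (Fin m → ℝ) → Finset (Fin m) → ℂ :=
  fun w => fderiv ℝ f w (Pi.single j 1)

/-- The creation operator `C_j f = w_j·f − ∂_{w_j} f`, acting componentwise. -/
noncomputable def CrE {m : ℕ} (j : Fin m) (f : (Fin m → ℝ) → Finset (Fin m) → ℂ) :
    (Fin m → ℝ) → Finset (Fin m) → ℂ :=
  fun w S => (w j : ℂ) * f w S - pdE j f w S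

/-- The annihilation operator `C_j^* f = w_j·f + ∂_{w_j} f`, acting componentwise. -/
noncomputable def AnE {m : ℕ} (j : Fin m) (f : (Fin m → ℝ) → Finset (Fin m) → ℂ) :
    (Fin m → ℝ) → Finset (Fin m) → ℂ :=
  fun w S => (w j : ℂ) * f w S + pdE j f w S

/-- The model operator `D₊ f = i·Σ_j (e_j(C_j f) − ε_j(C_j^* f))`. -/
noncomputable def Dplus {m : ℕ} (f : (Fin m → ℝ) → Finset (Fin m) → ℂ) :
    (Fin m → ℝ) → Finset (Fin m) → ℂ :=
  fun w => Complex.I • ∑ j, (contrOp j (CrE j f w) - wedgeOp j (AnE j f w))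

/-- The model operator `D₋ f = i·Σ_j (e_j(C_j^* f) − ε_j(C_j f))`. -/
noncomputable def Dminus {m : ℕ} (f : (Fin m → ℝ) → Finset (Fin m) → ℂ) :
    (Fin m → ℝ) → Finset (Fin m) → ℂ :=
  fun w => Complex.I • ∑ j, (contrOp j (AnE j f w) - wedgeOp j (CrE j f w))

/-! ### The canonical anticommutation relations on `Λ(ℂ^m)` -/

lemma basisSign_mul_self {m : ℕ} (j : Fin m) (S : Finset (Fin m)) :
    basisSign j S * basisSign j S = 1 := by
  rw [basisSign, ← mul_pow]
  simp

lemma basisSign_insert {m : ℕ} {j : Fin m} (k : Fin m) {S : Finset (Fin m)} (hj : j ∉ S) :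
    basisSign k (insert j S) = (if j < k then -1 else 1) * basisSign k S := by
  unfold basisSign
  rw [Finset.filter_insert]
  split_ifs with h
  · rw [Finset.card_insert_of_notMem (by simp [hj]), pow_succ]
    ring
  · simp

lemma basisSign_erase {m : ℕ} {j : Fin m} (k : Fin m) {S : Finset (Fin m)} (hj : j ∈ S) :
    basisSign k (S.erase j) = (if j < k then -1 else 1) * basisSign k S := by
  conv_rhs => rw [← Finset.insert_erase hj, basisSign_insert k (Finset.notMem_erase j S)]
  split_ifs <;> ring

/-- Exterior multiplication by the `j`-th basis vector, as a linear map. -/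
noncomputable def wedgeLin {m : ℕ} (j : Fin m) : Module.End ℂ (Finset (Fin m) → ℂ) where
  toFun := wedgeOp j
  map_add' f g := by
    ext S
    simp only [wedgeOp, Pi.add_apply]
    split_ifs <;> ring
  map_smul' c f := by
    ext S
    simp only [wedgeOp, Pi.smul_apply, smul_eq_mul, RingHom.id_apply]
    split_ifs <;> ring

/-- Contraction with the `j`-th dual basis vector, as a linear map. -/
noncomputable def contrLin {m : ℕ} (j : Fin m) : Module.End ℂ (Finset (Fin m) → ℂ) where
  toFun := contrOp j
  map_add' f g := by
    ext S
    simp only [contrOp, Pi.add_apply]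
    split_ifs <;> ring
  map_smul' c f := by
    ext S
    simp only [contrOp, Pi.smul_apply, smul_eq_mul, RingHom.id_apply]
    split_ifs <;> ring

lemma wedgeLin_apply {m : ℕ} (j : Fin m) (f : Finset (Fin m) → ℂ) :
    wedgeLin j f = wedgeOp j f := rfl

lemma contrLin_apply {m : ℕ} (j : Fin m) (f : Finset (Fin m) → ℂ) :
    contrLin j f = contrOp j f := rfl

lemma ite_lt_neg_one_swap {m : ℕ} {j k : Fin m} (h : j ≠ k) :
    (if k < j then (-1 : ℂ) else 1) = -(if j < k then (-1 : ℂ) else 1) := by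
  rcases lt_or_gt_of_ne h with h | h <;> simp [h, h.not_gt]

lemma contrLin_anticomm {m : ℕ} (j k : Fin m) :
    contrLin j * contrLin k + contrLin k * contrLin j = 0 := by
  refine LinearMap.ext fun f => ?_
  refine funext fun S => ?_
  simp only [LinearMap.add_apply, Module.End.mul_apply, contrLin_apply, Pi.add_apply,
    LinearMap.zero_apply, Pi.zero_apply, contrOp, Finset.mem_insert]
  by_cases h : j = k
  · subst h; simp
  by_cases hj : j ∈ S
  · simp [hj]
  by_cases hk : k ∈ S
  · simp [hk]
  simp only [hj, hk, h, Ne.symm h, or_self, if_false, basisSign_insert _ hj, basisSign_insert _ hk,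
    Finset.insert_comm k j, ite_lt_neg_one_swap h]
  ring

lemma wedgeLin_anticomm {m : ℕ} (j k : Fin m) :
    wedgeLin j * wedgeLin k + wedgeLin k * wedgeLin j = 0 := by
  refine LinearMap.ext fun f => ?_
  refine funext fun S => ?_
  simp only [LinearMap.add_apply, Module.End.mul_apply, wedgeLin_apply, Pi.add_apply,
    LinearMap.zero_apply, Pi.zero_apply, wedgeOp, Finset.mem_erase]
  by_cases h : j = k
  · subst h; simp
  by_cases hj : j ∈ S
  swap
  · simp [hj]
  by_cases hk : k ∈ S
  swap
  · simp [hk]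
  simp only [hj, hk, ne_eq, h, Ne.symm h, not_false_eq_true, and_self, if_true,
    basisSign_erase _ hj, basisSign_erase _ hk, Finset.erase_right_comm (a := k) (b := j),
    ite_lt_neg_one_swap h]
  ring

lemma contrLin_wedgeLin_anticomm {m : ℕ} (j k : Fin m) :
    contrLin j * wedgeLin k + wedgeLin k * contrLin j = if j = k then 1 else 0 := by
  refine LinearMap.ext fun f => ?_
  refine funext fun S => ?_
  by_cases h : j = k
  · subst h
    simp only [LinearMap.add_apply, Module.End.mul_apply, contrLin_apply, wedgeLin_apply,
      Pi.add_apply, wedgeOp, contrOp, Finset.mem_insert, Finset.mem_erase, if_true,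
      Module.End.one_apply]
    by_cases hj : j ∈ S
    · simp [hj, basisSign_erase _ hj, ← mul_assoc, basisSign_mul_self]
    · simp [hj, basisSign_insert _ hj, ← mul_assoc, basisSign_mul_self]
  · simp only [LinearMap.add_apply, Module.End.mul_apply, contrLin_apply, wedgeLin_apply,
      Pi.add_apply, wedgeOp, contrOp, Finset.mem_insert, Finset.mem_erase, h, if_false,
      LinearMap.zero_apply, Pi.zero_apply]
    by_cases hj : j ∈ S
    · simp [hj, h]
    by_cases hk : k ∈ S
    swap
    · simp [hk, Ne.symm h]
    simp only [hj, hk, or_true, and_false, if_true, if_false, basisSign_insert _ hj,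
      basisSign_erase _ hk, Finset.erase_insert_of_ne h, ite_lt_neg_one_swap h]
    ring

/-! ### Partial derivatives -/

lemma pdE_linearMap_comp {m : ℕ} (A : Module.End ℂ (Finset (Fin m) → ℂ)) (j : Fin m)
    {g : (Fin m → ℝ) → Finset (Fin m) → ℂ} {w : Fin m → ℝ} (hg : DifferentiableAt ℝ g w) :
    pdE j (fun w => A (g w)) w = A (pdE j g w) := by
  have h := (((LinearMap.toContinuousLinearMap A).restrictScalars ℝ).hasFDerivAt (x := g w)).comp w
    hg.hasFDerivAt
  exact congrArg (fun L => L (Pi.single j 1)) h.fderiv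

lemma differentiable_linearMap_comp {m : ℕ} (A : Module.End ℂ (Finset (Fin m) → ℂ))
    {g : (Fin m → ℝ) → Finset (Fin m) → ℂ} (hg : Differentiable ℝ g) :
    Differentiable ℝ fun w => A (g w) :=
  ((LinearMap.toContinuousLinearMap A).restrictScalars ℝ).differentiable.comp hg

lemma differentiable_coord_smul {m : ℕ} (k : Fin m)
    {g : (Fin m → ℝ) → Finset (Fin m) → ℂ} (hg : Differentiable ℝ g) :
    Differentiable ℝ fun w : Fin m → ℝ => w k • g w :=
  (differentiable_apply k).smul hg

lemma pdE_coord_smul {m : ℕ} (j k : Fin m)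
    {g : (Fin m → ℝ) → Finset (Fin m) → ℂ} {w : Fin m → ℝ} (hg : DifferentiableAt ℝ g w) :
    pdE j (fun w => w k • g w) w = w k • pdE j g w + if j = k then g w else 0 := by
  have h := (hasFDerivAt_apply (𝕜 := ℝ) k w).smul hg.hasFDerivAt
  refine (congrArg (fun L => L (Pi.single j 1)) h.fderiv).trans ?_
  by_cases hjk : j = k
  · subst hjk; simp [pdE]
  · simp [pdE, hjk, Ne.symm hjk]

lemma differentiable_pdE {m : ℕ} {f : (Fin m → ℝ) → Finset (Fin m) → ℂ}
    (hf : ContDiff ℝ 2 f) (j : Fin m) : Differentiable ℝ (pdE j f) :=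
  ((hf.fderiv_right (m := 1) (by norm_num)).differentiable (by norm_num)).clm_apply
    (differentiable_const _)

lemma pdE_comm {m : ℕ} {f : (Fin m → ℝ) → Finset (Fin m) → ℂ}
    (hf : ContDiff ℝ 2 f) (j k : Fin m) (w : Fin m → ℝ) :
    pdE j (pdE k f) w = pdE k (pdE j f) w := by
  have hd : Differentiable ℝ (fderiv ℝ f) :=
    (hf.fderiv_right (m := 1) (by norm_num)).differentiable (by norm_num)
  have key (a b : Fin m) : pdE a (pdE b f) w
      = fderiv ℝ (fderiv ℝ f) w (Pi.single a 1) (Pi.single b 1) := by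
    have h := (hd w).hasFDerivAt.clm_apply
      (hasFDerivAt_const (Pi.single b (1 : ℝ) : Fin m → ℝ) w)
    refine (congrArg (fun L => L (Pi.single a 1)) h.fderiv).trans ?_
    simp
  rw [key, key]
  exact (hf.contDiffAt.isSymmSndFDerivAt (by simp)).eq _ _

/-! ### Squares of first-order operators with Clifford coefficients -/

lemma sum_sum_eq_of_add_swap {ι V : Type*} [Fintype ι] [DecidableEq ι] [AddCommGroup V]
    [Module ℂ V] (T : ι → ι → V) (U : ι → V)
    (h : ∀ j k, T j k + T k j = if j = k then (2 : ℂ) • U j else 0) :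
    ∑ j, ∑ k, T j k = ∑ j, U j := by
  have h2 : (2 : ℂ) • ∑ j, ∑ k, T j k = (2 : ℂ) • ∑ j, U j := by
    rw [two_smul]
    nth_rw 2 [Finset.sum_comm]
    simp_rw [← Finset.sum_add_distrib, h]
    simp [Finset.smul_sum]
  exact smul_right_injective V (two_ne_zero' ℂ) h2

/-- The first-order operator `f ↦ ∑_j (w_j A_j f + B_j ∂_{w_j} f)`. -/
noncomputable def firstOrderOp {m : ℕ} (A B : Fin m → Module.End ℂ (Finset (Fin m) → ℂ))
    (f : (Fin m → ℝ) → Finset (Fin m) → ℂ) : (Fin m → ℝ) → Finset (Fin m) → ℂ :=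
  fun w => ∑ j, (w j • A j (f w) + B j (pdE j f w))

lemma pdE_firstOrderOp {m : ℕ} (A B : Fin m → Module.End ℂ (Finset (Fin m) → ℂ))
    {f : (Fin m → ℝ) → Finset (Fin m) → ℂ} (hf : ContDiff ℝ 2 f) (j : Fin m) (w : Fin m → ℝ) :
    pdE j (firstOrderOp A B f) w =
      ∑ k, (w k • A k (pdE j f w) + B k (pdE j (pdE k f) w)) + A j (f w) := by
  have hfd : Differentiable ℝ f := hf.differentiable (by norm_num)
  have hA (k) := differentiable_linearMap_comp (A k) hfd
  have hwA (k) := differentiable_coord_smul k (hA k)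
  have hB (k) := differentiable_linearMap_comp (B k) (differentiable_pdE hf k)
  have hsum : pdE j (firstOrderOp A B f) w = ∑ k, (pdE j (fun w => w k • A k (f w)) w
      + pdE j (fun w => B k (pdE k f w)) w) := by
    have h := HasFDerivAt.fun_sum (u := Finset.univ) fun k _ =>
      ((hwA k) w).hasFDerivAt.add ((hB k) w).hasFDerivAt
    refine (congrArg (fun L => L (Pi.single j 1)) h.fderiv).trans ?_
    simp [pdE]
  rw [hsum]
  simp only [pdE_coord_smul j _ (hA _ w), pdE_linearMap_comp _ j (hfd w),
    pdE_linearMap_comp _ j (differentiable_pdE hf _ w), Finset.sum_add_distrib,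
    Finset.sum_ite_eq, Finset.mem_univ, if_true]
  abel

lemma firstOrderOp_sq {m : ℕ} (A B : Fin m → Module.End ℂ (Finset (Fin m) → ℂ))
    (hAA : ∀ j k, A j * A k + A k * A j = if j = k then 2 else 0)
    (hBB : ∀ j k, B j * B k + B k * B j = if j = k then -2 else 0)
    (hAB : ∀ j k, A j * B k + B k * A j = 0)
    {f : (Fin m → ℝ) → Finset (Fin m) → ℂ} (hf : ContDiff ℝ 2 f) (w : Fin m → ℝ) :
    firstOrderOp A B (firstOrderOp A B f) w =
      ∑ j, ((w j * w j) • f w - pdE j (pdE j f) w + B j (A j (f w))) := by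
  have hAA' (j k) (v) : A j (A k v) + A k (A j v) = if j = k then (2 : ℂ) • v else 0 := by
    have := LinearMap.congr_fun (hAA j k) v
    split_ifs at this ⊢ <;> simpa [two_smul] using this
  have hBB' (j k) (v) : B j (B k v) + B k (B j v) = if j = k then -((2 : ℂ) • v) else 0 := by
    have := LinearMap.congr_fun (hBB j k) v
    split_ifs at this ⊢ <;> simpa [two_smul] using this
  have hAB' (j k) (v) : A j (B k v) = - B k (A j v) :=
    eq_neg_of_add_eq_zero_left (LinearMap.congr_fun (hAB j k) v)
  have expand : firstOrderOp A B (firstOrderOp A B f) w =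
      ∑ j, ∑ k, ((w j * w k) • A j (A k (f w)) + w j • A j (B k (pdE k f w))
        + w k • B j (A k (pdE j f w)) + B j (B k (pdE j (pdE k f) w)))
      + ∑ j, B j (A j (f w)) := by
    rw [firstOrderOp]
    simp only [pdE_firstOrderOp A B hf, map_add, map_sum]
    simp only [firstOrderOp, map_sum, map_add, LinearMap.map_smul_of_tower, Finset.smul_sum,
      smul_add, smul_smul, Finset.sum_add_distrib]
    abel
  rw [expand, Finset.sum_add_distrib]
  congr 1
  refine sum_sum_eq_of_add_swap _ _ fun j k => ?_
  have h1 := congrArg (fun v => (w j * w k) • v) (hAA' j k (f w))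
  have h2 := hBB' j k (pdE j (pdE k f) w)
  simp only [smul_add] at h1
  rw [pdE_comm hf k j, hAB', hAB', mul_comm (w k) (w j)]
  have h3 : (w j * w k) • A j (A k (f w)) + w j • -B k (A j (pdE k f w))
        + w k • B j (A k (pdE j f w)) + B j (B k (pdE j (pdE k f) w))
      + ((w j * w k) • A k (A j (f w)) + w k • -B j (A k (pdE j f w))
        + w j • B k (A j (pdE k f w)) + B k (B j (pdE j (pdE k f) w)))
      = ((w j * w k) • A j (A k (f w)) + (w j * w k) • A k (A j (f w)))
        + (B j (B k (pdE j (pdE k f) w)) + B k (B j (pdE j (pdE k f) w))) := by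
    simp only [smul_neg]
    abel
  rw [h3, h1, h2]
  split_ifs with h
  · subst h
    rw [smul_sub, smul_comm, sub_eq_add_neg]
  · simp

lemma CrE_AnE {m : ℕ} {f : (Fin m → ℝ) → Finset (Fin m) → ℂ} (hf : ContDiff ℝ 2 f)
    (j : Fin m) (w : Fin m → ℝ) :
    CrE j (AnE j f) w = (w j * w j) • f w - pdE j (pdE j f) w - f w := by
  have hfd : Differentiable ℝ f := hf.differentiable (by norm_num)
  have h : pdE j (AnE j f) w = w j • pdE j f w + f w + pdE j (pdE j f) w := by
    have hsum : pdE j (AnE j f) w = pdE j (fun w => w j • f w) w + pdE j (pdE j f) w := by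
      have h := ((differentiable_coord_smul j hfd) w).hasFDerivAt.add
        ((differentiable_pdE hf j) w).hasFDerivAt
      exact congrArg (fun L => L (Pi.single j 1)) h.fderiv
    rw [hsum, pdE_coord_smul j j (hfd w), if_pos rfl]
  ext S
  simp only [CrE, h]
  simp [AnE]
  ring

lemma Dplus_eq_firstOrderOp {m : ℕ} (f : (Fin m → ℝ) → Finset (Fin m) → ℂ) :
    Dplus f = firstOrderOp (fun j => Complex.I • (contrLin j - wedgeLin j))
      (fun j => (-Complex.I) • (contrLin j + wedgeLin j)) f := by
  funext w
  have hC (j) : CrE j f w = w j • f w - pdE j f w := by ext S; simp [CrE]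
  have hA (j) : AnE j f w = w j • f w + pdE j f w := by ext S; simp [AnE]
  simp only [Dplus, firstOrderOp, ← contrLin_apply, ← wedgeLin_apply, hC, hA, Finset.smul_sum]
  refine Finset.sum_congr rfl fun j _ => ?_
  simp only [map_add, map_sub, LinearMap.map_smul_of_tower, LinearMap.smul_apply,
    LinearMap.sub_apply, LinearMap.add_apply, smul_comm (w j) Complex.I, smul_sub, smul_add]
  simp only [neg_smul]
  abel

lemma Dminus_eq_firstOrderOp {m : ℕ} (f : (Fin m → ℝ) → Finset (Fin m) → ℂ) :
    Dminus f = firstOrderOp (fun j => Complex.I • (contrLin j - wedgeLin j))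
      (fun j => Complex.I • (contrLin j + wedgeLin j)) f := by
  funext w
  have hC (j) : CrE j f w = w j • f w - pdE j f w := by ext S; simp [CrE]
  have hA (j) : AnE j f w = w j • f w + pdE j f w := by ext S; simp [AnE]
  simp only [Dminus, firstOrderOp, ← contrLin_apply, ← wedgeLin_apply, hC, hA, Finset.smul_sum]
  refine Finset.sum_congr rfl fun j _ => ?_
  simp only [map_add, map_sub, LinearMap.map_smul_of_tower, LinearMap.smul_apply,
    LinearMap.sub_apply, LinearMap.add_apply, smul_comm (w j) Complex.I,
    smul_sub, smul_add]
  abel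

lemma smul_anticomm {m : ℕ} (a b : ℂ) (X Y : Module.End ℂ (Finset (Fin m) → ℂ)) :
    (a • X) * (b • Y) + (b • Y) * (a • X) = (a * b) • (X * Y + Y * X) := by
  rw [smul_mul_smul_comm, smul_mul_smul_comm, mul_comm b a, smul_add]

lemma contrLin_sub_wedgeLin_anticomm {m : ℕ} (j k : Fin m) :
    (contrLin j - wedgeLin j) * (contrLin k - wedgeLin k)
      + (contrLin k - wedgeLin k) * (contrLin j - wedgeLin j) = if j = k then -2 else 0 := by
  have h : (if j = k then (-2 : Module.End ℂ (Finset (Fin m) → ℂ)) else 0)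
      = (contrLin j * contrLin k + contrLin k * contrLin j)
        + (wedgeLin j * wedgeLin k + wedgeLin k * wedgeLin j)
        - (contrLin j * wedgeLin k + wedgeLin k * contrLin j)
        - (contrLin k * wedgeLin j + wedgeLin j * contrLin k) := by
    rw [contrLin_wedgeLin_anticomm, contrLin_wedgeLin_anticomm, contrLin_anticomm,
      wedgeLin_anticomm]
    simp only [eq_comm (a := k)]
    split_ifs <;> norm_num
  rw [h]
  simp only [sub_mul, mul_sub]
  abel

lemma contrLin_add_wedgeLin_anticomm {m : ℕ} (j k : Fin m) :
    (contrLin j + wedgeLin j) * (contrLin k + wedgeLin k)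
      + (contrLin k + wedgeLin k) * (contrLin j + wedgeLin j) = if j = k then 2 else 0 := by
  have h : (if j = k then (2 : Module.End ℂ (Finset (Fin m) → ℂ)) else 0)
      = (contrLin j * contrLin k + contrLin k * contrLin j)
        + (wedgeLin j * wedgeLin k + wedgeLin k * wedgeLin j)
        + (contrLin j * wedgeLin k + wedgeLin k * contrLin j)
        + (contrLin k * wedgeLin j + wedgeLin j * contrLin k) := by
    rw [contrLin_wedgeLin_anticomm, contrLin_wedgeLin_anticomm, contrLin_anticomm,
      wedgeLin_anticomm]
    simp only [eq_comm (a := k)]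
    split_ifs <;> norm_num
  rw [h]
  simp only [add_mul, mul_add]
  abel

lemma contrLin_sub_add_wedgeLin_anticomm {m : ℕ} (j k : Fin m) :
    (contrLin j - wedgeLin j) * (contrLin k + wedgeLin k)
      + (contrLin k + wedgeLin k) * (contrLin j - wedgeLin j) = 0 := by
  have h : (0 : Module.End ℂ (Finset (Fin m) → ℂ))
      = (contrLin j * contrLin k + contrLin k * contrLin j)
        - (wedgeLin j * wedgeLin k + wedgeLin k * wedgeLin j)
        + (contrLin j * wedgeLin k + wedgeLin k * contrLin j)
        - (contrLin k * wedgeLin j + wedgeLin j * contrLin k) := by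
    rw [contrLin_wedgeLin_anticomm, contrLin_wedgeLin_anticomm, contrLin_anticomm,
      wedgeLin_anticomm]
    simp [eq_comm (a := k)]
  rw [h]
  simp only [sub_mul, mul_sub, add_mul, mul_add]
  abel

lemma contrLin_add_mul_sub_wedgeLin {m : ℕ} (j : Fin m) :
    (contrLin j + wedgeLin j) * (contrLin j - wedgeLin j)
      = wedgeLin j * contrLin j - contrLin j * wedgeLin j := by
  have hc : contrLin j * contrLin j = 0 := by
    simpa [← two_smul ℂ] using contrLin_anticomm j j
  have hw : wedgeLin j * wedgeLin j = 0 := by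
    simpa [← two_smul ℂ] using wedgeLin_anticomm j j
  rw [add_mul, mul_sub, mul_sub, hc, hw]
  abel

lemma firstOrderOp_contrLin_wedgeLin_sq {m : ℕ} {s : ℂ} (hs : s * s = -1)
    {f : (Fin m → ℝ) → Finset (Fin m) → ℂ} (hf : ContDiff ℝ 2 f) (w : Fin m → ℝ) :
    firstOrderOp (fun j => Complex.I • (contrLin j - wedgeLin j))
        (fun j => s • (contrLin j + wedgeLin j))
        (firstOrderOp (fun j => Complex.I • (contrLin j - wedgeLin j))
          (fun j => s • (contrLin j + wedgeLin j)) f) w =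
      ∑ j, (CrE j (AnE j f) w + f w
        + (s * Complex.I) • (wedgeOp j (contrOp j (f w)) - contrOp j (wedgeOp j (f w)))) := by
  rw [firstOrderOp_sq _ _ _ _ _ hf]
  · refine Finset.sum_congr rfl fun j _ => ?_
    have h := LinearMap.congr_fun (contrLin_add_mul_sub_wedgeLin j) (f w)
    rw [CrE_AnE hf, sub_add_cancel, LinearMap.smul_apply, LinearMap.smul_apply, map_smul,
      smul_smul]
    exact congrArg (fun v => _ + (s * Complex.I) • v) h
  · intro j k
    rw [smul_anticomm, contrLin_sub_wedgeLin_anticomm, Complex.I_mul_I]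
    split_ifs
    · exact LinearMap.ext fun v => by simp
    · exact smul_zero _
  · intro j k
    rw [smul_anticomm, contrLin_add_wedgeLin_anticomm, hs]
    split_ifs
    · exact LinearMap.ext fun v => by simp
    · exact smul_zero _
  · intro j k
    rw [smul_anticomm, contrLin_sub_add_wedgeLin_anticomm, smul_zero]

/-- For a twice continuously differentiable `f : ℝ^m → Λ(ℂ^m)`,
`D₊(D₊ f) = Σ_j C_j(C_j^* f) + 2·Σ_j ε_j(e_j f)` and
`D₋(D₋ f) = Σ_j C_j(C_j^* f) + 2·Σ_j e_j(ε_j f)`. -/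
theorem stmt_18 {m : ℕ} (f : (Fin m → ℝ) → Finset (Fin m) → ℂ)
    (hf : ContDiff ℝ 2 f) :
    (Dplus (Dplus f) = fun w =>
        (∑ j, CrE j (AnE j f) w) + (2 : ℂ) • ∑ j, wedgeOp j (contrOp j (f w))) ∧
      (Dminus (Dminus f) = fun w =>
        (∑ j, CrE j (AnE j f) w) + (2 : ℂ) • ∑ j, contrOp j (wedgeOp j (f w))) := by
  have hone (j) (w) : f w = contrOp j (wedgeOp j (f w)) + wedgeOp j (contrOp j (f w)) := by
    have h := LinearMap.congr_fun (contrLin_wedgeLin_anticomm j j) (f w)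
    rw [if_pos rfl] at h
    exact h.symm
  constructor
  · funext w
    rw [Dplus_eq_firstOrderOp, Dplus_eq_firstOrderOp,
      firstOrderOp_contrLin_wedgeLin_sq (by simp) hf, Finset.smul_sum, ← Finset.sum_add_distrib]
    refine Finset.sum_congr rfl fun j _ => ?_
    rw [add_assoc, neg_mul, Complex.I_mul_I, neg_neg, one_smul, two_smul]
    nth_rw 1 [hone j w]
    abel
  · funext w
    rw [Dminus_eq_firstOrderOp, Dminus_eq_firstOrderOp,
      firstOrderOp_contrLin_wedgeLin_sq Complex.I_mul_I hf, Finset.smul_sum,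
      ← Finset.sum_add_distrib]
    refine Finset.sum_congr rfl fun j _ => ?_
    rw [add_assoc, Complex.I_mul_I, neg_one_smul, two_smul]
    nth_rw 1 [hone j w]
    abel
end
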